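/- arXiv:2505.03933 — 2 statements merged into one kernel-verified Lean document; each statement's English description precedes it below -/
import Mathlib

section
/- Let X be a Lelek-like fan with top v and let x ∈ X. Then x ∈ NS(X) if and only if there is a sequence (x_n) of pairwise distinct end-points of X converging to x such that the sequence of arcs ([v,x_n]) does not converge to [v,x] in the Hausdorff metric. -/
open Set Filter Topology

/-- A set `A` is an arc if it is homeomorphic to the closed unit interval `[0,1]`. -/
def IsArc {X : Type} [TopologicalSpace X] (A : Set X) : Prop :=
  Nonempty (↥(Set.Icc (0:ℝ) 1) ≃ₜ ↥A)

/-- `x` is an end-point of the arc `A`: some homeomorphism `[0,1] ≃ₜ A` sends `0` to `x`. -/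
def IsArcEndpoint {X : Type} [TopologicalSpace X] (A : Set X) (x : X) : Prop :=
  ∃ e : ↥(Set.Icc (0:ℝ) 1) ≃ₜ ↥A, ((e ⟨0, le_refl 0, zero_le_one⟩ : A) : X) = x

/-- A subcontinuum: a nonempty compact connected subset. -/
def IsSubcontinuum {X : Type} [TopologicalSpace X] (A : Set X) : Prop :=
  IsCompact A ∧ IsConnected A

/-- Every subcontinuum `C` is unicoherent: whenever `C = A ∪ B` with `A`, `B`
subcontinua, the intersection `A ∩ B` is connected. -/
def HereditarilyUnicoherent (X : Type) [TopologicalSpace X] : Prop :=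
  ∀ C A B : Set X, IsSubcontinuum C → IsSubcontinuum A → IsSubcontinuum B →
    A ∪ B = C → IsConnected (A ∩ B)

/-- A dendroid: an arcwise connected, hereditarily unicoherent (metrizable) continuum. -/
def IsDendroid (X : Type) [TopologicalSpace X] : Prop :=
  Nonempty X ∧ CompactSpace X ∧ ConnectedSpace X ∧ TopologicalSpace.MetrizableSpace X ∧
  (∀ x y : X, x ≠ y → ∃ A : Set X, IsArcEndpoint A x ∧ IsArcEndpoint A y) ∧
  HereditarilyUnicoherent X

/-- The set of end-points of a dendroid: points which are end-points of every arc
containing them. -/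
def DendroidEndpoints (X : Type) [TopologicalSpace X] : Set X :=
  {x | ∀ A : Set X, IsArc A → x ∈ A → IsArcEndpoint A x}

/-- The model simple triode `([-1,1] × {0}) ∪ ({0} × [0,1]) ⊆ ℝ²`. -/
def TSet : Set (ℝ × ℝ) := (Set.Icc (-1:ℝ) 1 ×ˢ ({0} : Set ℝ)) ∪ (({0} : Set ℝ) ×ˢ Set.Icc (0:ℝ) 1)

lemma zero_mem_TSet : ((0:ℝ), (0:ℝ)) ∈ TSet :=
  Or.inl ⟨⟨by norm_num, by norm_num⟩, rfl⟩

/-- `T` is a simple triode with top `x`: some homeomorphism from the model triode onto `T`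
sends `(0,0)` to `x`. -/
def IsSimpleTriodeWithTop {X : Type} [TopologicalSpace X] (T : Set X) (x : X) : Prop :=
  ∃ e : ↥TSet ≃ₜ ↥T, ((e ⟨((0:ℝ), (0:ℝ)), zero_mem_TSet⟩ : T) : X) = x

/-- `x` is a ramification point: the top of some simple triode contained in the space. -/
def IsRamificationPoint {X : Type} [TopologicalSpace X] (x : X) : Prop :=
  ∃ T : Set X, IsSimpleTriodeWithTop T x

/-- A fan: a dendroid with at most one ramification point. -/
def IsFan (X : Type) [TopologicalSpace X] : Prop :=
  IsDendroid X ∧ ∀ x y : X, IsRamificationPoint x → IsRamificationPoint y → x = y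

/-- `v` is the top of the fan: its ramification point if one exists, otherwise an end-point. -/
def IsFanTop {X : Type} [TopologicalSpace X] (v : X) : Prop :=
  IsRamificationPoint v ∨
    ((∀ x : X, ¬ IsRamificationPoint x) ∧ v ∈ DendroidEndpoints X)

/-- A Lelek-like fan: a fan whose set of end-points is dense. -/
def IsLelekLikeFan (X : Type) [TopologicalSpace X] : Prop :=
  IsFan X ∧ Dense (DendroidEndpoints X)
/-- `A` is the (unique) arc in the fan joining `x` and `y`, where `[x,x] = {x}`. -/
def ArcConn {X : Type} [TopologicalSpace X] (A : Set X) (x y : X) : Prop :=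
  (x = y ∧ A = {x}) ∨ (x ≠ y ∧ IsArcEndpoint A x ∧ IsArcEndpoint A y)

/-- `x` is a non-smooth point of a fan with top `v`: there is a sequence `(xₙ)` of pairwise
distinct points converging to `x` such that the arcs `[v,xₙ]` do not converge to `[v,x]`
in the Hausdorff metric. -/
def NSPoint {X : Type} [MetricSpace X] (v x : X) : Prop :=
  ∃ xs : ℕ → X,
    (∀ m n : ℕ, m ≠ n → xs m ≠ xs n) ∧
    Filter.Tendsto xs Filter.atTop (nhds x) ∧
    ∃ (As : ℕ → Set X) (A₀ : Set X),
      (∀ n, ArcConn (As n) v (xs n)) ∧ ArcConn A₀ v x ∧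
      ¬ Filter.Tendsto (fun n => EMetric.hausdorffEdist (As n) A₀) Filter.atTop (nhds 0)

/-- The set of non-smooth points of a fan with top `v`. -/
def NS (X : Type) [MetricSpace X] (v : X) : Set X := {x | NSPoint v x}

/-- A fan with top `v` is smooth if whenever `xₙ → x`, the arcs `[v,xₙ]` converge to
`[v,x]` in the Hausdorff metric. -/
def SmoothFan (X : Type) [MetricSpace X] (v : X) : Prop :=
  ∀ (x : X) (xs : ℕ → X), Filter.Tendsto xs Filter.atTop (nhds x) →
    ∀ (As : ℕ → Set X) (A₀ : Set X),
      (∀ n, ArcConn (As n) v (xs n)) → ArcConn A₀ v x →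
      Filter.Tendsto (fun n => EMetric.hausdorffEdist (As n) A₀) Filter.atTop (nhds 0)

/-- A Lelek fan: a smooth fan with top `v` and a dense set of end-points. -/
def IsLelekFan (X : Type) [MetricSpace X] (v : X) : Prop :=
  IsFan X ∧ IsFanTop v ∧ SmoothFan X v ∧ Dense (DendroidEndpoints X)

/-- A self-homeomorphism of `[0,1]` sends `0` to `0` or to `1`. -/
lemma Homeomorph.unitInterval_zero_eq (f : unitInterval ≃ₜ unitInterval) :
    f 0 = 0 ∨ f 0 = 1 := by
  rcases f.continuous.strictMono_of_inj_boundedOrder' f.injective with h | h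
  · obtain ⟨s, hs⟩ := f.surjective 0
    exact Or.inl (le_antisymm
      ((h.monotone (unitInterval.nonneg' (t := s))).trans_eq hs) unitInterval.nonneg')
  · obtain ⟨s, hs⟩ := f.surjective 1
    exact Or.inr (le_antisymm unitInterval.le_one'
      (hs.symm.trans_le (h.antitone (unitInterval.nonneg' (t := s)))))

section Arcs

variable {X : Type} [TopologicalSpace X] {A K : Set X} {x y : X}

/-- An arc is irreducible between its end-points. -/
lemma IsArcEndpoint.subset_of_isPreconnected (hx : IsArcEndpoint A x) (hy : IsArcEndpoint A y)
    (hxy : x ≠ y) (hK : IsPreconnected K) (hKA : K ⊆ A) (hxK : x ∈ K) (hyK : y ∈ K) :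
    A ⊆ K := by
  obtain ⟨e, rfl⟩ := hx
  obtain ⟨e', rfl⟩ := hy
  have h1 : e.symm (e' 0) = 1 := by
    rcases (e'.trans e.symm).unitInterval_zero_eq with h | h
    · refine absurd (congrArg Subtype.val ?_) hxy
      exact e.symm_apply_eq.1 h |>.symm
    · exact h
  have hpre : IsPreconnected (Subtype.val ⁻¹' K : Set A) := by
    rw [← Topology.IsInducing.subtypeVal.isPreconnected_image,
      Subtype.image_preimage_coe, inter_eq_right.2 hKA]
    exact hK
  have hord := (hpre.image e.symm e.symm.continuous.continuousOn).ordConnected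
  intro z hz
  obtain ⟨w, hw, hwz⟩ := hord.out (x := 0) (y := 1) ⟨e 0, hxK, e.symm_apply_apply 0⟩
    ⟨e' 0, hyK, h1⟩ (show e.symm ⟨z, hz⟩ ∈ Icc 0 1 from
      ⟨unitInterval.nonneg', unitInterval.le_one'⟩)
  rw [e.symm.injective hwz] at hw
  exact hw

lemma IsArcEndpoint.mem (hx : IsArcEndpoint A x) : x ∈ A := by
  obtain ⟨e, rfl⟩ := hx
  exact Subtype.coe_prop _

lemma IsArcEndpoint.isSubcontinuum (hx : IsArcEndpoint A x) : IsSubcontinuum A := by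
  obtain ⟨e, -⟩ := hx
  have : CompactSpace A := e.compactSpace
  have : ConnectedSpace A := e.surjective.connectedSpace e.continuous
  exact ⟨isCompact_iff_compactSpace.2 inferInstance, isConnected_iff_connectedSpace.2 this⟩

namespace ArcConn

lemma left_mem (h : ArcConn A x y) : x ∈ A := by
  rcases h with ⟨-, rfl⟩ | ⟨-, hx, -⟩
  exacts [mem_singleton x, hx.mem]

lemma right_mem (h : ArcConn A x y) : y ∈ A := by
  rcases h with ⟨rfl, rfl⟩ | ⟨-, -, hy⟩
  exacts [mem_singleton x, hy.mem]

lemma isSubcontinuum (h : ArcConn A x y) : IsSubcontinuum A := by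
  rcases h with ⟨-, rfl⟩ | ⟨-, hx, -⟩
  exacts [⟨isCompact_singleton, isConnected_singleton⟩, hx.isSubcontinuum]

/-- In a hereditarily unicoherent space, a subcontinuum containing `x` and `y` contains
every arc joining them. -/
lemma subset_of_isSubcontinuum (h : ArcConn A x y) (hX : HereditarilyUnicoherent X)
    (hK : IsSubcontinuum K) (hx : x ∈ K) (hy : y ∈ K) : A ⊆ K := by
  have hA := h.isSubcontinuum
  have hxA := h.left_mem
  have hyA := h.right_mem
  have hAK : IsConnected (A ∩ K) := hX (A ∪ K) A K
    ⟨hA.1.union hK.1, hA.2.union ⟨x, hxA, hx⟩ hK.2⟩ hA hK rfl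
  rcases h with ⟨-, rfl⟩ | ⟨hne, hx', hy'⟩
  · exact singleton_subset_iff.2 hx
  · exact (hx'.subset_of_isPreconnected hy' hne hAK.isPreconnected inter_subset_left
      ⟨hxA, hx⟩ ⟨hyA, hy⟩).trans inter_subset_right

end ArcConn

lemma IsDendroid.exists_arcConn (hX : IsDendroid X) (x y : X) : ∃ A, ArcConn A x y := by
  by_cases h : x = y
  · exact ⟨{x}, Or.inl ⟨h, rfl⟩⟩
  · obtain ⟨A, hA⟩ := hX.2.2.2.2.1 x y h
    exact ⟨A, Or.inr ⟨h, hA⟩⟩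

end Arcs

section Metric

variable {X : Type} [MetricSpace X] {A : Set X} {v x : X}

/-- In a dendroid, an open set meeting the arc `[v,x]` meets all arcs `[v,y]` with `y` close
to `x`. -/
lemma ArcConn.eventually_inter_nonempty (h : ArcConn A v x) (hX : IsDendroid X) {U : Set X}
    (hU : IsOpen U) (hAU : (A ∩ U).Nonempty) :
    ∀ᶠ y in 𝓝 x, ∀ B, ArcConn B v y → (B ∩ U).Nonempty := by
  have : CompactSpace X := hX.2.1
  by_contra hcon
  let S : Set (Set X) := {B | (∃ y, ArcConn B v y) ∧ ¬ (B ∩ U).Nonempty}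
  have hfreq : ∃ᶠ y in 𝓝 x, y ∈ ⋃₀ S := by
    refine (not_eventually.1 hcon).mono fun y hy ↦ ?_
    push Not at hy
    obtain ⟨B, hB, hBU⟩ := hy
    exact ⟨B, ⟨⟨y, hB⟩, not_nonempty_iff_eq_empty.2 hBU⟩, hB.right_mem⟩
  have hvS : v ∈ ⋃₀ S := by
    obtain ⟨y, B, hB, -⟩ := hfreq.exists
    exact ⟨B, hB, hB.1.choose_spec.left_mem⟩
  have hpre : IsPreconnected (⋃₀ S) :=
    isPreconnected_sUnion v S (fun B hB ↦ hB.1.choose_spec.left_mem)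
      fun B hB ↦ hB.1.choose_spec.isSubcontinuum.2.isPreconnected
  have hsub : A ⊆ closure (⋃₀ S) := h.subset_of_isSubcontinuum hX.2.2.2.2.2
    ⟨isClosed_closure.isCompact, ⟨v, subset_closure hvS⟩, hpre.closure⟩
    (subset_closure hvS) (mem_closure_iff_frequently.2 hfreq)
  obtain ⟨b, hbA, hbU⟩ := hAU
  obtain ⟨c, hcU, B, hB, hcB⟩ := mem_closure_iff.1 (hsub hbA) U hU hbU
  exact hB.2 ⟨c, hcB, hcU⟩

/-- In a dendroid, `y ↦ [v,y]` is lower semicontinuous. -/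
lemma ArcConn.eventually_infEDist_le (h : ArcConn A v x) (hX : IsDendroid X) {δ : ENNReal}
    (hδ : 0 < δ) :
    ∀ᶠ y in 𝓝 x, ∀ B, ArcConn B v y → ∀ a ∈ A, Metric.infEDist a B ≤ δ := by
  have hδ2 : 0 < δ / 2 := ENNReal.half_pos hδ.ne'
  refine h.isSubcontinuum.1.induction_on
    (p := fun s ↦ ∀ᶠ y in 𝓝 x, ∀ B, ArcConn B v y → ∀ a ∈ s, Metric.infEDist a B ≤ δ)
    (by simp) (fun s t hst ht ↦ ht.mono fun y hy B hB a ha ↦ hy B hB a (hst ha))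
    (fun s t hs ht ↦ ?_) fun b hb ↦ ?_
  · filter_upwards [hs, ht] with y h1 h2 B hB a ha
    exact ha.elim (h1 B hB a) (h2 B hB a)
  · refine ⟨A ∩ Metric.eball b (δ / 2),
      inter_mem_nhdsWithin _ (Metric.eball_mem_nhds b hδ2), ?_⟩
    filter_upwards [h.eventually_inter_nonempty hX Metric.isOpen_eball
      ⟨b, hb, Metric.mem_eball_self hδ2⟩] with y hy B hB a ha
    obtain ⟨c, hcB, hc⟩ := hy B hB
    calc Metric.infEDist a B ≤ edist a c := Metric.infEDist_le_edist_of_mem hcB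
      _ ≤ edist a b + edist b c := edist_triangle _ _ _
      _ ≤ δ / 2 + δ / 2 := add_le_add ha.2.le (edist_comm b c ▸ le_of_lt hc)
      _ = δ := ENNReal.add_halves δ

end Metric

/-- One can choose pairwise distinct representatives from a sequence of infinite sets. -/
lemma exists_injective_forall_mem_of_infinite {α : Type*} {T : ℕ → Set α}
    (hT : ∀ n, (T n).Infinite) : ∃ f : ℕ → α, Function.Injective f ∧ ∀ n, f n ∈ T n := by
  classical
  choose g hgT hg using fun n (F : Finset α) ↦ (hT n).exists_notMem_finset F
  let F : ℕ → Finset α := fun n ↦ Nat.rec ∅ (fun n F ↦ insert (g n F) F) n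
  have hF : Monotone F := monotone_nat_of_le_succ fun n ↦ Finset.subset_insert _ _
  refine ⟨fun n ↦ g n (F n), Function.Injective.of_lt_imp_ne fun m n hmn he ↦ hg n (F n) ?_,
    fun n ↦ hgT n (F n)⟩
  exact he ▸ hF (Nat.succ_le_of_lt hmn) (Finset.mem_insert_self (g m (F m)) (F m))

/-- In a Lelek-like fan `X` with top `v`, a point `x` is non-smooth iff there is a sequence
of pairwise distinct end-points converging to `x` whose arcs from `v` do not converge to
`[v,x]` in the Hausdorff metric. -/
theorem statement7 {X : Type} [MetricSpace X] (v : X) (hX : IsFan X) (hv : IsFanTop v)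
    (hLL : Dense (DendroidEndpoints X)) (x : X) :
    x ∈ NS X v ↔
      ∃ xs : ℕ → X,
        (∀ n, xs n ∈ DendroidEndpoints X) ∧
        (∀ m n : ℕ, m ≠ n → xs m ≠ xs n) ∧
        Filter.Tendsto xs Filter.atTop (nhds x) ∧
        ∃ (As : ℕ → Set X) (A₀ : Set X),
          (∀ n, ArcConn (As n) v (xs n)) ∧ ArcConn A₀ v x ∧
          ¬ Filter.Tendsto (fun n => EMetric.hausdorffEdist (As n) A₀) Filter.atTop (nhds 0) := by
  have hD := hX.1
  have : CompactSpace X := hD.2.1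
  have : ConnectedSpace X := hD.2.2.1
  constructor
  swap
  · rintro ⟨xs, -, hinj, hlim, hA⟩
    exact ⟨xs, hinj, hlim, hA⟩
  rintro ⟨xs, hinj, hlim, As, A₀, hAs, hA₀, hnot⟩
  have : Nontrivial X := ⟨xs 0, xs 1, hinj 0 1 zero_ne_one⟩
  let δ : ℕ → ENNReal := fun n ↦ (n : ENNReal)⁻¹
  have hδ : ∀ n, 0 < δ n := fun n ↦ ENNReal.inv_pos.2 (ENNReal.natCast_ne_top n)
  have hδlim : Tendsto δ atTop (𝓝 0) := ENNReal.tendsto_inv_nat_nhds_zero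
  let P : ℕ → X → Prop := fun n y ↦ edist y (xs n) < δ n ∧
    ∀ B, ArcConn B v y → ∀ a ∈ As n, Metric.infEDist a B ≤ δ n
  have hP : ∀ n, (DendroidEndpoints X ∩ {y | P n y}).Infinite := by
    intro n
    have hnhds : {y | P n y} ∈ 𝓝 (xs n) :=
      inter_mem (Metric.eball_mem_nhds (xs n) (hδ n)) ((hAs n).eventually_infEDist_le hD (hδ n))
    intro hfin
    obtain ⟨y, ⟨hyE, hyF⟩, hy⟩ := (hLL.sdiff_finite hfin).inter_nhds_nonempty hnhds
    exact hyF ⟨hyE, hy⟩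
  obtain ⟨es, hes, hmem⟩ := exists_injective_forall_mem_of_infinite hP
  choose B hB using fun n ↦ hD.exists_arcConn v (es n)
  refine ⟨es, fun n ↦ (hmem n).1, fun m n hmn ↦ hes.ne hmn, ?_, B, A₀, hB, hA₀, fun hBA ↦ hnot ?_⟩
  · rw [tendsto_iff_edist_tendsto_0] at hlim ⊢
    refine tendsto_of_tendsto_of_tendsto_of_le_of_le tendsto_const_nhds
      (by simpa using hδlim.add hlim) (fun n ↦ zero_le) fun n ↦ ?_
    exact (edist_triangle _ (xs n) _).trans (add_le_add (hmem n).2.1.le le_rfl)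
  · rw [ENNReal.tendsto_nhds_zero]
    intro ε hε
    have hsum : Tendsto (fun n ↦ δ n + Metric.hausdorffEDist (B n) A₀) atTop (𝓝 0) := by
      rw [← add_zero (0 : ENNReal)]
      exact hδlim.add hBA
    filter_upwards [ENNReal.tendsto_nhds_zero.1 hsum ε hε,
      hlim.eventually (hA₀.eventually_infEDist_le hD hε)] with n h1 h2
    refine Metric.hausdorffEDist_le_of_infEDist (fun a ha ↦ ?_) (h2 (As n) (hAs n))
    exact (Metric.infEDist_le_infEDist_add_hausdorffEDist.trans
      (add_le_add ((hmem n).2.2 (B n) (hB n) a ha) le_rfl)).trans h1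
end

section
/- For every (r,ρ) ∈ NC, the shift σ_H induces a well-defined homeomorphism σ_H^⋆ of 𝕏_H/~₂ given by [x] ↦ [σ_H(x)], and the dynamical system (𝕏_H/~₂, σ_H^⋆) is topologically mixing. -/
/-- A dynamical system is topologically mixing if for all nonempty open sets `U`, `V`
there is `n₀` such that `f^[n] '' U` meets `V` for every `n ≥ n₀`. -/
def TopologicallyMixing {X : Type} [TopologicalSpace X] (f : X → X) : Prop :=
  ∀ U V : Set X, IsOpen U → IsOpen V → U.Nonempty → V.Nonempty →
    ∃ n₀ : ℕ, ∀ n : ℕ, n₀ ≤ n → (f^[n] '' U ∩ V).Nonempty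

/-- A dynamical system is (topologically) transitive if for all nonempty open sets `U`, `V`
there is `n ≥ 0` such that `f^[n] '' U` meets `V`. -/
def TopologicallyTransitive {X : Type} [TopologicalSpace X] (f : X → X) : Prop :=
  ∀ U V : Set X, IsOpen U → IsOpen V → U.Nonempty → V.Nonempty →
    ∃ n : ℕ, (f^[n] '' U ∩ V).Nonempty
/-- The Mahavier product of a closed relation `F` on `X`: all forward `F`-orbits. -/
def MahavierPlus {X : Type} (F : Set (X × X)) : Set (ℕ → X) :=
  {x | ∀ i : ℕ, (x i, x (i+1)) ∈ F}

/-- The two-sided Mahavier product of a closed relation `F` on `X`. -/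
def MahavierTwo {X : Type} (F : Set (X × X)) : Set (ℤ → X) :=
  {x | ∀ i : ℤ, (x i, x (i+1)) ∈ F}

/-- The shift map `σ_F⁺` on the Mahavier product. -/
def shiftPlus {X : Type} (F : Set (X × X)) (x : ↥(MahavierPlus F)) : ↥(MahavierPlus F) :=
  ⟨fun i => x.1 (i+1), fun i => x.2 (i+1)⟩

/-- The shift map `σ_F` on the two-sided Mahavier product. -/
def shiftTwo {X : Type} (F : Set (X × X)) (x : ↥(MahavierTwo F)) : ↥(MahavierTwo F) :=
  ⟨fun i => x.1 (i+1), fun i => x.2 (i+1)⟩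
/-- The locally compact space `[0,1] ∪ [2,3] ∪ [4,5] ∪ ⋯ ⊆ ℝ` (so `I_k = [2k-2, 2k-1]`). -/
def Ybase : Set ℝ := {x : ℝ | ∃ k : ℕ, x ∈ Set.Icc (2*(k:ℝ)) (2*(k:ℝ)+1)}

/-- The compact space `𝕏`: the one-point compactification of `[0,1] ∪ [2,3] ∪ [4,5] ∪ ⋯`. -/
abbrev XSpace : Type := OnePoint ↥Ybase
/-- The relation `H` on `𝕏` (for parameters `r < 1 < ρ`): `t ↦ rt` and `t ↦ ρt` on
`I₁ = [0,1]` (the latter where `ρt ≤ 1`), `t ↦ t+2` on `⋃_{k≥1} I_k`, `t ↦ t-2` on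
`⋃_{k≥2} I_k`, the identity on `⋃_{k≥1} I_k`, and `(∞,∞)`. -/
def Hrel (r ρ : ℝ) : Set (XSpace × XSpace) :=
  {p | ∃ y z : Ybase, (y:ℝ) ≤ 1 ∧ (z:ℝ) = r * (y:ℝ) ∧ p = ((y : XSpace), (z : XSpace))} ∪
  {p | ∃ y z : Ybase, (y:ℝ) ≤ 1 ∧ ρ * (y:ℝ) ≤ 1 ∧ (z:ℝ) = ρ * (y:ℝ) ∧
        p = ((y : XSpace), (z : XSpace))} ∪
  {p | ∃ y z : Ybase, (z:ℝ) = (y:ℝ) + 2 ∧ p = ((y : XSpace), (z : XSpace))} ∪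
  {p | ∃ y z : Ybase, 2 ≤ (y:ℝ) ∧ (z:ℝ) = (y:ℝ) - 2 ∧ p = ((y : XSpace), (z : XSpace))} ∪
  {p | ∃ y : Ybase, p = ((y : XSpace), (y : XSpace))} ∪
  {(OnePoint.infty, OnePoint.infty)}

/-- `(r,ρ) ∈ 𝒩𝒞`: `r` and `ρ` never connect. -/
def NeverConnect (r ρ : ℝ) : Prop :=
  0 < r ∧ r < 1 ∧ 1 < ρ ∧ ∀ k l : ℤ, r ^ k = ρ ^ l ↔ k = 0 ∧ l = 0
/-- A point of `𝕏` lying in `{0, 2, 4, 6, …}`. -/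
def IsEvenPt (a : XSpace) : Prop :=
  ∃ (m : ℕ) (h : (2*(m:ℝ)) ∈ Ybase), a = ((⟨2*(m:ℝ), h⟩ : Ybase) : XSpace)

/-- The relation `~₁` on `𝕏_H⁺`: `x ~₁ y` iff `x = y` or all coordinates of both `x` and
`y` lie in `{0,2,4,6,…}`. -/
def relOne (r ρ : ℝ) (x y : ↥(MahavierPlus (Hrel r ρ))) : Prop :=
  x = y ∨ ∀ i : ℕ, IsEvenPt (x.1 i) ∧ IsEvenPt (y.1 i)

/-- The relation `~₂` on `𝕏_H`: `x ~₂ y` iff `x = y` or all coordinates of both `x` and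
`y` lie in `{0,2,4,6,…}`. -/
def relTwo (r ρ : ℝ) (x y : ↥(MahavierTwo (Hrel r ρ))) : Prop :=
  x = y ∨ ∀ i : ℤ, IsEvenPt (x.1 i) ∧ IsEvenPt (y.1 i)

section Density

variable {r ρ : ℝ}

theorem NeverConnect.irrational_log_div_log (h : NeverConnect r ρ) :
    Irrational (-Real.log r / Real.log ρ) := by
  obtain ⟨hr0, hr1, hρ, hc⟩ := h
  have hβ : 0 < Real.log ρ := Real.log_pos hρ
  rintro ⟨q, hq⟩
  have hden : (0 : ℝ) < q.den := by exact_mod_cast q.den_pos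
  have hlog : -Real.log r * q.den = q.num * Real.log ρ := by
    rw [Rat.cast_def] at hq
    field_simp at hq
    linarith
  have hpow : r ^ (q.den : ℤ) = ρ ^ (-q.num) := by
    apply Real.log_injOn_pos (Set.mem_Ioi.2 (zpow_pos hr0 _))
      (Set.mem_Ioi.2 (zpow_pos (zero_lt_one.trans hρ) _))
    rw [Real.log_zpow, Real.log_zpow]
    push_cast
    linarith
  have := ((hc _ _).1 hpow).1
  exact q.den_nz (by exact_mod_cast this)

/-- The numbers `n β - m α` with natural `m`, `n` are dense if `α / β` is irrational. -/
theorem exists_nat_mul_sub_mem_Ioo {α β A B : ℝ} (hα : 0 < α) (hβ : 0 < β)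
    (hirr : Irrational (α / β)) (hAB : A < B) :
    ∃ m n : ℕ, n * β - m * α ∈ Set.Ioo A B := by
  have : Fact (0 < β) := ⟨hβ⟩
  have hd : DenseRange (· • ((-α : ℝ) : AddCircle β) : ℕ → AddCircle β) := by
    rw [← denseRange_zsmul_iff_nsmul, AddCircle.denseRange_zsmul_coe_iff, neg_div]
    exact hirr.neg
  obtain ⟨K, hK⟩ := exists_nat_gt (-A / α)
  rw [div_lt_iff₀ hα] at hK
  have hopen : IsOpen ((↑) '' Set.Ioo (A + K * α) (B + K * α) : Set (AddCircle β)) :=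
    QuotientAddGroup.isOpenMap_coe _ isOpen_Ioo
  obtain ⟨m, x, hx, hm⟩ := hd.exists_mem_open hopen
    ((Set.nonempty_Ioo.2 (by linarith)).image _)
  have hm' : ((x : ℝ) : AddCircle β) = ((m • (-α) : ℝ) : AddCircle β) := by
    rw [hm, AddCircle.coe_nsmul]
  rw [QuotientAddGroup.eq, AddSubgroup.mem_zmultiples_iff] at hm'
  obtain ⟨z, hz⟩ := hm'
  simp only [zsmul_eq_mul, nsmul_eq_mul] at hz
  have hx0 : 0 < x := by linarith [hx.1]
  have hzneg : z < 0 := by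
    by_contra! hcon
    have h1 : (0 : ℝ) ≤ z := by exact_mod_cast hcon
    have h2 : (0 : ℝ) ≤ z * β := by positivity
    have h3 : (0 : ℝ) ≤ m * α := by positivity
    linarith
  obtain ⟨n, hn⟩ := Int.eq_ofNat_of_zero_le (Int.neg_nonneg_of_nonpos hzneg.le)
  have hn' : (n : ℝ) = -z := by exact_mod_cast hn.symm
  refine ⟨m + K, n, ?_, ?_⟩ <;> rw [hn'] <;> push_cast <;> linarith [hx.1, hx.2]

theorem NeverConnect.exists_pow_mul_pow_mem_Ioo (h : NeverConnect r ρ) {u v : ℝ} (hu : 0 < u)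
    (huv : u < v) : ∃ m n : ℕ, ρ ^ n * r ^ m ∈ Set.Ioo u v := by
  have hr0 := h.1
  have hρ0 := zero_lt_one.trans h.2.2.1
  obtain ⟨m, n, hA, hB⟩ := exists_nat_mul_sub_mem_Ioo (neg_pos.2 (Real.log_neg hr0 h.2.1))
    (Real.log_pos h.2.2.1) h.irrational_log_div_log (Real.log_lt_log hu huv)
  have hlog : Real.log (ρ ^ n * r ^ m) = n * Real.log ρ - m * -Real.log r := by
    rw [Real.log_mul (by positivity) (by positivity), Real.log_pow, Real.log_pow]
    ring
  rw [← hlog] at hA hB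
  exact ⟨m, n, (Real.log_lt_log_iff hu (by positivity)).1 hA,
    (Real.log_lt_log_iff (by positivity) (hu.trans huv)).1 hB⟩

end Density

section Coordinates

/-- The point `2 k + s` of `𝕏`, with `s` clamped to `[0, 1]`. -/
noncomputable def levelPt (a : ℕ × ℝ) : XSpace :=
  ((⟨2 * (a.1 : ℝ) + Set.projIcc 0 1 zero_le_one a.2, a.1, by
    have := (Set.projIcc (0 : ℝ) 1 zero_le_one a.2).2
    exact ⟨by linarith [this.1], by linarith [this.2]⟩⟩ : Ybase) : XSpace)

theorem levelPt_eq {k : ℕ} {s : ℝ} (hs : s ∈ Set.Icc (0 : ℝ) 1) :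
    ∃ h : 2 * (k : ℝ) + s ∈ Ybase, levelPt (k, s) = ((⟨_, h⟩ : Ybase) : XSpace) := by
  refine ⟨⟨k, by linarith [hs.1], by linarith [hs.2]⟩, ?_⟩
  simp [levelPt, Set.projIcc_of_mem zero_le_one hs]

theorem continuous_levelPt (k : ℕ) : Continuous fun s => levelPt (k, s) := by
  unfold levelPt
  refine OnePoint.continuous_coe.comp (Continuous.subtype_mk ?_ _)
  have h : Continuous fun s => (Set.projIcc (0 : ℝ) 1 zero_le_one s : ℝ) :=
    continuous_subtype_val.comp continuous_projIcc
  exact h.const_add (2 * (k : ℝ))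

theorem tendsto_levelPt_infty (s : ℝ) :
    Filter.Tendsto (fun k : ℕ => levelPt (k, s)) Filter.atTop (nhds OnePoint.infty) := by
  rw [OnePoint.hasBasis_nhds_infty.tendsto_right_iff]
  rintro K ⟨-, hK⟩
  obtain ⟨C, hC⟩ := (hK.image continuous_subtype_val).bddAbove
  obtain ⟨M, hM⟩ := exists_nat_gt C
  filter_upwards [Filter.eventually_ge_atTop M] with k hk
  refine Or.inl ⟨_, fun hmem => ?_, rfl⟩
  have h1 := hC (Set.mem_image_of_mem _ hmem)
  have h2 := (Set.projIcc (0 : ℝ) 1 zero_le_one s).2.1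
  have h3 : (M : ℝ) ≤ k := by exact_mod_cast hk
  have h4 : (0 : ℝ) ≤ k := k.cast_nonneg
  simp only at h1
  linarith

/-- The relation `H` in the coordinates `(k, s) ↦ 2 k + s`. -/
def LevelStep (r ρ : ℝ) (a b : ℕ × ℝ) : Prop :=
  a.2 ∈ Set.Icc (0 : ℝ) 1 ∧ b.2 ∈ Set.Icc (0 : ℝ) 1 ∧
    ((a.1 = 0 ∧ b.1 = 0 ∧ (b.2 = r * a.2 ∨ b.2 = ρ * a.2)) ∨
      (b.2 = a.2 ∧ (b.1 = a.1 + 1 ∨ a.1 = b.1 + 1 ∨ b.1 = a.1)))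

/-- A two-sided orbit of `H` in the coordinates `(k, s) ↦ 2 k + s`. -/
def LevelOrbit (r ρ : ℝ) (w : ℤ → ℕ × ℝ) : Prop :=
  ∀ i, LevelStep r ρ (w i) (w (i + 1))

variable {r ρ : ℝ}

theorem LevelStep.mem_Hrel {a b : ℕ × ℝ} (h : LevelStep r ρ a b) :
    (levelPt a, levelPt b) ∈ Hrel r ρ := by
  obtain ⟨k, s⟩ := a
  obtain ⟨l, t⟩ := b
  obtain ⟨hs, ht, h⟩ := h
  obtain ⟨hy, ey⟩ := levelPt_eq (k := k) hs
  obtain ⟨hz, ez⟩ := levelPt_eq (k := l) ht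
  rw [ey, ez]
  simp only at hs ht h
  simp only [Hrel, Set.mem_union, Set.mem_ofPred_eq]
  rcases h with ⟨rfl, rfl, h | h⟩ | ⟨rfl, rfl | rfl | rfl⟩
  · refine .inl <| .inl <| .inl <| .inl <| .inl ⟨⟨_, hy⟩, ⟨_, hz⟩, ?_, ?_, rfl⟩
    · simpa using hs.2
    · simpa using h
  · refine .inl <| .inl <| .inl <| .inl <| .inr ⟨⟨_, hy⟩, ⟨_, hz⟩, ?_, ?_, ?_, rfl⟩
    · simpa using hs.2
    · simpa [← h] using ht.2
    · simpa using h
  · refine .inl <| .inl <| .inl <| .inr ⟨⟨_, hy⟩, ⟨_, hz⟩, ?_, rfl⟩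
    push_cast
    ring
  · refine .inl <| .inl <| .inr ⟨⟨_, hy⟩, ⟨_, hz⟩, ?_, ?_, rfl⟩
    · push_cast
      linarith [hs.1, (l.cast_nonneg : (0 : ℝ) ≤ l)]
    · push_cast
      ring
  · exact .inl <| .inr ⟨⟨_, hy⟩, rfl⟩

theorem level_unique {k l : ℕ} {s t : ℝ} (hs : s ∈ Set.Icc (0 : ℝ) 1)
    (ht : t ∈ Set.Icc (0 : ℝ) 1) (h : 2 * (k : ℝ) + s = 2 * l + t) : k = l ∧ s = t := by
  have hkl : k = l := by
    have h1 : (k : ℝ) < l + 1 := by linarith [hs.1, ht.2]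
    have h2 : (l : ℝ) < k + 1 := by linarith [hs.2, ht.1]
    have h1' : k < l + 1 := by exact_mod_cast h1
    have h2' : l < k + 1 := by exact_mod_cast h2
    omega
  subst hkl
  exact ⟨rfl, by linarith⟩

theorem level_eq_zero {k : ℕ} {s : ℝ} (hs : s ∈ Set.Icc (0 : ℝ) 1)
    (h : 2 * (k : ℝ) + s ≤ 1) : k = 0 := by
  have h1 : (k : ℝ) < 1 := by linarith [hs.1]
  exact_mod_cast Nat.lt_one_iff.1 (by exact_mod_cast h1)

theorem levelStep_of_mem_Hrel (hr0 : 0 < r) (hr1 : r < 1) {a b : ℕ × ℝ}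
    (ha : a.2 ∈ Set.Icc (0 : ℝ) 1) (hb : b.2 ∈ Set.Icc (0 : ℝ) 1)
    (h : (levelPt a, levelPt b) ∈ Hrel r ρ) : LevelStep r ρ a b := by
  obtain ⟨k, s⟩ := a
  obtain ⟨l, t⟩ := b
  refine ⟨ha, hb, ?_⟩
  obtain ⟨hy, ey⟩ := levelPt_eq (k := k) ha
  obtain ⟨hz, ez⟩ := levelPt_eq (k := l) hb
  rw [ey, ez] at h
  simp only at ha hb ⊢
  simp only [Hrel, Set.mem_union, Set.mem_ofPred_eq, Set.mem_singleton_iff, Prod.mk.injEq,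
    OnePoint.coe_eq_coe, OnePoint.coe_ne_infty, false_and, or_false] at h
  have hl : (0 : ℝ) ≤ l := l.cast_nonneg
  rcases h with (((⟨y, z, h1, h2, rfl, rfl⟩ | ⟨y, z, h1, h2, h3, rfl, rfl⟩) |
    ⟨y, z, h1, rfl, rfl⟩) | ⟨y, z, h1, h2, rfl, rfl⟩) | ⟨y, rfl, h1⟩
  · simp only at h1 h2
    obtain rfl := level_eq_zero ha h1
    simp only [Nat.cast_zero, mul_zero, zero_add] at h1 h2
    obtain rfl := level_eq_zero (k := l) hb (by nlinarith [ha.1])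
    simp only [Nat.cast_zero, mul_zero, zero_add] at h2
    exact .inl ⟨rfl, rfl, .inl h2⟩
  · simp only at h1 h2 h3
    obtain rfl := level_eq_zero ha h1
    simp only [Nat.cast_zero, mul_zero, zero_add] at h1 h2 h3
    obtain rfl := level_eq_zero (k := l) hb (by linarith)
    simp only [Nat.cast_zero, mul_zero, zero_add] at h3
    exact .inl ⟨rfl, rfl, .inr h3⟩
  · simp only at h1
    obtain ⟨h, h'⟩ := level_unique (k := l) (l := k + 1) hb ha (by push_cast; linarith)
    exact .inr ⟨h', .inl h⟩
  · simp only at h1 h2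
    obtain ⟨h, h'⟩ := level_unique (k := l + 1) (l := k) hb ha (by push_cast; linarith)
    exact .inr ⟨h', .inr (.inl h.symm)⟩
  · rw [Subtype.mk.injEq] at h1
    obtain ⟨h, h'⟩ := level_unique hb ha h1
    exact .inr ⟨h', .inr (.inr h)⟩

theorem LevelStep.refl {a : ℕ × ℝ} (ha : a.2 ∈ Set.Icc (0 : ℝ) 1) : LevelStep r ρ a a :=
  ⟨ha, ha, .inr ⟨rfl, .inr (.inr rfl)⟩⟩

theorem LevelStep.scale {a b : ℕ × ℝ} (h : LevelStep r ρ a b) {c : ℝ}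
    (hc : c ∈ Set.Icc (0 : ℝ) 1) : LevelStep r ρ (a.1, c * a.2) (b.1, c * b.2) := by
  obtain ⟨ha, hb, h⟩ := h
  refine ⟨⟨mul_nonneg hc.1 ha.1, mul_le_one₀ hc.2 ha.1 ha.2⟩,
    ⟨mul_nonneg hc.1 hb.1, mul_le_one₀ hc.2 hb.1 hb.2⟩, ?_⟩
  rcases h with ⟨h1, h2, h3 | h3⟩ | ⟨h1, h2⟩
  · exact .inl ⟨h1, h2, .inl (by simp only [h3]; ring)⟩
  · exact .inl ⟨h1, h2, .inr (by simp only [h3]; ring)⟩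
  · exact .inr ⟨by simp only [h1], h2⟩

theorem LevelStep.eq_zero_iff {a b : ℕ × ℝ} (hr : r ≠ 0) (hρ : ρ ≠ 0) (h : LevelStep r ρ a b) :
    a.2 = 0 ↔ b.2 = 0 := by
  rcases h.2.2 with ⟨-, -, h | h⟩ | ⟨h, -⟩ <;> simp [h, hr, hρ]

theorem LevelStep.lift_of_eq_zero {a b : ℕ × ℝ} (h : LevelStep r ρ a b) {e : ℝ}
    (he : e ∈ Set.Icc (0 : ℝ) 1) : LevelStep r ρ (a.1, e) (b.1, e) := by
  refine ⟨he, he, .inr ⟨rfl, ?_⟩⟩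
  rcases h.2.2 with ⟨h1, h2, -⟩ | ⟨-, h⟩
  · exact .inr (.inr (by simp [h1, h2]))
  · exact h

/-- The point of the Mahavier product given by an orbit in coordinates. -/
noncomputable def LevelOrbit.toPt {w : ℤ → ℕ × ℝ} (hw : LevelOrbit r ρ w) :
    ↥(MahavierTwo (Hrel r ρ)) :=
  ⟨fun i => levelPt (w i), fun i => (hw i).mem_Hrel⟩

theorem iff_of_forall_iff_succ {P : ℤ → Prop} (h : ∀ i, P i ↔ P (i + 1)) (i j : ℤ) :
    P i ↔ P j := by
  have key : ∀ i, P i ↔ P 0 := by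
    intro i
    induction i using Int.induction_on with
    | zero => rfl
    | succ n ih => rw [← h, ih]
    | pred n ih => rw [← ih, h, sub_add_cancel]
  rw [key i, key j]

theorem eq_infty_iff_of_mem_Hrel {a b : XSpace} (h : (a, b) ∈ Hrel r ρ) :
    a = OnePoint.infty ↔ b = OnePoint.infty := by
  simp only [Hrel, Set.mem_union, Set.mem_ofPred_eq, Set.mem_singleton_iff, Prod.mk.injEq] at h
  rcases h with ((((⟨y, z, -, -, rfl, rfl⟩ | ⟨y, z, -, -, -, rfl, rfl⟩) |
    ⟨y, z, -, rfl, rfl⟩) | ⟨y, z, -, -, rfl, rfl⟩) | ⟨y, rfl, rfl⟩) | ⟨rfl, rfl⟩ <;> simp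

theorem exists_levelPt_eq {a : XSpace} (ha : a ≠ OnePoint.infty) :
    ∃ b : ℕ × ℝ, b.2 ∈ Set.Icc (0 : ℝ) 1 ∧ levelPt b = a := by
  obtain ⟨⟨y, k, hk⟩, rfl⟩ := OnePoint.ne_infty_iff_exists.1 ha
  have hs : y - 2 * k ∈ Set.Icc (0 : ℝ) 1 := ⟨by linarith [hk.1], by linarith [hk.2]⟩
  obtain ⟨h, e⟩ := levelPt_eq (k := k) hs
  refine ⟨(k, y - 2 * k), hs, ?_⟩
  rw [e]
  simp

theorem eq_infty_or_exists_levelOrbit (hr0 : 0 < r) (hr1 : r < 1)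
    (x : ↥(MahavierTwo (Hrel r ρ))) :
    (∀ i, x.1 i = OnePoint.infty) ∨ ∃ w, ∃ hw : LevelOrbit r ρ w, hw.toPt = x := by
  have hiff := iff_of_forall_iff_succ (P := fun i => x.1 i = OnePoint.infty)
    fun i => eq_infty_iff_of_mem_Hrel (x.2 i)
  by_cases h0 : x.1 0 = OnePoint.infty
  · exact .inl fun i => (hiff i 0).2 h0
  · choose w hw hwx using fun i => exists_levelPt_eq (mt (hiff i 0).1 h0)
    refine .inr ⟨w, fun i => ?_, Subtype.ext (funext hwx)⟩
    apply levelStep_of_mem_Hrel hr0 hr1 (hw _) (hw _)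
    rw [hwx, hwx]
    exact x.2 i

end Coordinates

section Dynamics

variable {r ρ : ℝ}

theorem tendsto_mahavierTwo {X α : Type} [TopologicalSpace X] {F : Set (X × X)}
    {f : α → ↥(MahavierTwo F)} {l : Filter α} {x : ↥(MahavierTwo F)}
    (h : ∀ i, Filter.Tendsto (fun a => (f a).1 i) l (nhds (x.1 i))) :
    Filter.Tendsto f l (nhds x) :=
  tendsto_subtype_rng.2 (tendsto_pi_nhds.2 h)

/-- The orbits which are neither `∞` nor on the left endpoints are dense. -/
theorem exists_levelOrbit_pos_mem (hr0 : 0 < r) (hr1 : r < 1) (hρ : 1 < ρ)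
    {U : Set ↥(MahavierTwo (Hrel r ρ))} (hU : IsOpen U) (hne : U.Nonempty) :
    ∃ w, ∃ hw : LevelOrbit r ρ w, hw.toPt ∈ U ∧ ∀ i, 0 < (w i).2 := by
  obtain ⟨x, hx⟩ := hne
  rcases eq_infty_or_exists_levelOrbit hr0 hr1 x with h | ⟨w, hw, rfl⟩
  · have horb : ∀ k : ℕ, LevelOrbit r ρ fun _ => (k, 1) :=
      fun k i => LevelStep.refl ⟨zero_le_one, le_rfl⟩
    have ht : Filter.Tendsto (fun k => (horb k).toPt) Filter.atTop (nhds x) :=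
      tendsto_mahavierTwo fun i => by
        rw [h i]
        exact tendsto_levelPt_infty 1
    obtain ⟨k, hk⟩ := (ht.eventually_mem (hU.mem_nhds hx)).exists
    exact ⟨_, horb k, hk, fun _ => one_pos⟩
  have hiff := iff_of_forall_iff_succ (P := fun i => (w i).2 = 0)
    fun i => (hw i).eq_zero_iff hr0.ne' (zero_lt_one.trans hρ).ne'
  by_cases h0 : (w 0).2 = 0
  · have horb : ∀ e : Set.Icc (0 : ℝ) 1, LevelOrbit r ρ fun i => ((w i).1, (e : ℝ)) :=
      fun e i => (hw i).lift_of_eq_zero e.2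
    have hcont : Continuous fun e => (horb e).toPt :=
      Continuous.subtype_mk (continuous_pi fun i =>
        (continuous_levelPt (w i).1).comp continuous_subtype_val) _
    have hmem : (horb ⟨0, le_rfl, zero_le_one⟩).toPt ∈ U := by
      convert! hx using 1
      refine Subtype.ext (funext fun i => ?_)
      simp only [LevelOrbit.toPt]
      rw [← (hiff i 0).2 h0]
    have hn := hcont.continuousAt (hU.mem_nhds hmem)
    obtain ⟨δ, hδ, hball⟩ := Metric.mem_nhds_iff.1 hn
    have he : min (δ / 2) 1 ∈ Set.Icc (0 : ℝ) 1 := ⟨by positivity, min_le_right _ _⟩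
    refine ⟨_, horb ⟨_, he⟩, hball ?_, fun _ => by positivity⟩
    rw [Metric.mem_ball, Subtype.dist_eq, Real.dist_eq, sub_zero, abs_of_nonneg he.1]
    exact (min_le_left _ _).trans_lt (by linarith)
  · exact ⟨w, hw, hx, fun i => lt_of_le_of_ne (hw i).1.1 (Ne.symm (mt (hiff i 0).1 h0))⟩

/-- Membership in a neighbourhood of an orbit is decided on a finite window, uniformly under
scaling the orbit by factors close to `1`. -/
theorem LevelOrbit.exists_window {w : ℤ → ℕ × ℝ} (hw : LevelOrbit r ρ w)
    {U : Set ↥(MahavierTwo (Hrel r ρ))} (hU : IsOpen U) (hmem : hw.toPt ∈ U) :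
    ∃ N : ℕ, ∃ δ > 0, ∀ c : ℝ, 1 - δ < c → c ≤ 1 → ∀ z : ↥(MahavierTwo (Hrel r ρ)),
      (∀ i : ℤ, |i| ≤ N → z.1 i = levelPt ((w i).1, c * (w i).2)) → z ∈ U := by
  obtain ⟨O, hO, rfl⟩ := isOpen_induced_iff.1 hU
  obtain ⟨I, u, hu, hIu⟩ := isOpen_pi_iff.1 hO _ hmem
  have hev : ∀ᶠ c : ℝ in nhds 1, ∀ i ∈ I, levelPt ((w i).1, c * (w i).2) ∈ u i := by
    rw [Filter.eventually_all_finset]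
    intro i hi
    have hc : Continuous fun c : ℝ => levelPt ((w i).1, c * (w i).2) :=
      (continuous_levelPt _).comp (continuous_id.mul continuous_const)
    refine hc.continuousAt.eventually_mem ((hu i hi).1.mem_nhds ?_)
    rw [one_mul]
    exact (hu i hi).2
  obtain ⟨δ, hδ, hball⟩ := Metric.eventually_nhds_iff.1 hev
  refine ⟨I.sup Int.natAbs, δ, hδ, fun c hc1 hc2 z hz => hIu fun i hi => ?_⟩
  have hi' : |i| ≤ ((I.sup Int.natAbs : ℕ) : ℤ) := by
    rw [Int.abs_eq_natAbs]
    exact_mod_cast Finset.le_sup (f := Int.natAbs) hi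
  rw [hz i hi']
  refine hball ?_ i hi
  rw [Real.dist_eq, abs_lt]
  constructor <;> linarith

/-- Two orbits can be glued at a common position. -/
theorem LevelOrbit.glue {v w : ℤ → ℕ × ℝ} (hv : LevelOrbit r ρ v) (hw : LevelOrbit r ρ w)
    {m n : ℤ} (h : v m = w n) :
    ∃ z, LevelOrbit r ρ z ∧ (∀ i ≤ m, z i = v i) ∧ ∀ j ≥ n, z (j + (m - n)) = w j := by
  refine ⟨fun i => if i ≤ m then v i else w (i - (m - n)), fun i => ?_, fun i hi => if_pos hi,
    fun j hj => ?_⟩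
  · rcases lt_trichotomy i m with hi | rfl | hi
    · simpa [hi.le, Int.add_one_le_iff.2 hi] using hv i
    · have := hw n
      rw [← h] at this
      simpa [show i + 1 - (i - n) = n + 1 by ring] using this
    · have := hw (i - (m - n))
      simpa [not_le.2 hi, not_le.2 (hi.trans (lt_add_one i)),
        show i - (m - n) + 1 = i + 1 - (m - n) by ring] using this
  · rcases hj.eq_or_lt with rfl | hj
    · simp [h]
    · have : ¬ j + (m - n) ≤ m := by linarith
      simp [this]

/-- If `b` is reachable from `a`, then an orbit through `a` can be modified after `a` so as to be
at `b` at any prescribed sufficiently late time. -/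
theorem LevelOrbit.exists_eq_of_reflTransGen {a b : ℕ × ℝ}
    (h : Relation.ReflTransGen (LevelStep r ρ) a b) {v : ℤ → ℕ × ℝ} (hv : LevelOrbit r ρ v)
    {N : ℤ} (ha : v N = a) :
    ∃ m : ℕ, ∀ n ≥ m, ∃ z, LevelOrbit r ρ z ∧ (∀ i ≤ N, z i = v i) ∧ z (N + n) = b := by
  induction h with
  | refl =>
    have hconst : LevelOrbit r ρ fun _ => v N := fun _ => LevelStep.refl (hv N).1
    obtain ⟨z, hz, h1, h2⟩ := hv.glue hconst (m := N) (n := 0) rfl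
    refine ⟨0, fun n _ => ⟨z, hz, h1, ?_⟩⟩
    rw [← ha, ← h2 n (by simp)]
    congr 1
    ring
  | @tail b c _ hbc ih =>
    obtain ⟨m, hm⟩ := ih
    refine ⟨m + 1, fun n hn => ?_⟩
    obtain ⟨n, rfl⟩ := Nat.exists_eq_add_of_le' (Nat.one_le_of_lt hn)
    obtain ⟨z, hz, h1, h2⟩ := hm n (by omega)
    have hjump : LevelOrbit r ρ fun i : ℤ => if i ≤ 0 then b else c := by
      intro i
      rcases lt_trichotomy i 0 with hi | rfl | hi
      · simpa [hi.le, Int.add_one_le_iff.2 hi] using LevelStep.refl hbc.1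
      · simpa using hbc
      · simpa [not_le.2 hi, not_le.2 (hi.trans (lt_add_one i))] using LevelStep.refl hbc.2.1
    obtain ⟨z', hz', h1', h2'⟩ := hz.glue hjump (m := N + n) (n := 0) (by simpa using h2)
    refine ⟨z', hz', fun i hi => (h1' i (by linarith [n.cast_nonneg (α := ℤ)])).trans (h1 i hi),
      ?_⟩
    have := h2' 1 (by norm_num)
    simp only [show ¬ (1 : ℤ) ≤ 0 by norm_num, if_false] at this
    rw [← this]
    congr 1
    push_cast
    ring

theorem reflTransGen_level_zero {s : ℝ} (hs : s ∈ Set.Icc (0 : ℝ) 1) (k : ℕ) :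
    Relation.ReflTransGen (LevelStep r ρ) (k, s) (0, s) ∧
      Relation.ReflTransGen (LevelStep r ρ) (0, s) (k, s) := by
  induction k with
  | zero => exact ⟨.refl, .refl⟩
  | succ k ih =>
    exact ⟨.head (b := (k, s)) ⟨hs, hs, .inr ⟨rfl, .inr (.inl rfl)⟩⟩ ih.1,
      .tail ih.2 ⟨hs, hs, .inr ⟨rfl, .inl rfl⟩⟩⟩

theorem reflTransGen_mul_left_pow (hr0 : 0 < r) (hr1 : r < 1) {s : ℝ}
    (hs : s ∈ Set.Icc (0 : ℝ) 1) (m : ℕ) :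
    Relation.ReflTransGen (LevelStep r ρ) (0, s) (0, r ^ m * s) := by
  have hmem : ∀ m : ℕ, r ^ m * s ∈ Set.Icc (0 : ℝ) 1 := fun m =>
    ⟨mul_nonneg (by positivity) hs.1, mul_le_one₀ (pow_le_one₀ hr0.le hr1.le) hs.1 hs.2⟩
  induction m with
  | zero => simpa using Relation.ReflTransGen.refl
  | succ m ih =>
    exact ih.tail ⟨hmem m, hmem (m + 1), .inl ⟨rfl, rfl, .inl (by simp only [pow_succ]; ring)⟩⟩

theorem reflTransGen_mul_right_pow (hρ : 1 < ρ) {s : ℝ} (hs : 0 ≤ s) (n : ℕ)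
    (h : ρ ^ n * s ≤ 1) : Relation.ReflTransGen (LevelStep r ρ) (0, s) (0, ρ ^ n * s) := by
  induction n with
  | zero => simpa using Relation.ReflTransGen.refl
  | succ n ih =>
    have h0 : 0 ≤ ρ ^ n * s := by positivity
    have heq : ρ ^ (n + 1) * s = ρ * (ρ ^ n * s) := by ring
    have hle : ρ ^ n * s ≤ 1 := by nlinarith
    exact (ih hle).tail
      ⟨⟨h0, hle⟩, ⟨by simp only; positivity, h⟩, .inl ⟨rfl, rfl, .inr heq⟩⟩

theorem NeverConnect.exists_reflTransGen (h : NeverConnect r ρ) {a b : ℕ × ℝ}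
    (ha : a.2 ∈ Set.Ioc (0 : ℝ) 1) (hb : b.2 ∈ Set.Ioc (0 : ℝ) 1) {δ : ℝ} (hδ : 0 < δ) :
    ∃ c : ℝ, 0 < c ∧ 1 - δ < c ∧ c ≤ 1 ∧
      Relation.ReflTransGen (LevelStep r ρ) a (b.1, c * b.2) := by
  obtain ⟨k, s⟩ := a
  obtain ⟨l, t⟩ := b
  obtain ⟨hs0, hs1⟩ := ha
  obtain ⟨ht0, ht1⟩ := hb
  have hlt : max (1 - δ) (1 / 2) < 1 := max_lt (by linarith) (by norm_num)
  have hpos : 0 < max (1 - δ) (1 / 2) := lt_max_of_lt_right (by norm_num)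
  obtain ⟨m, n, hA, hB⟩ := h.exists_pow_mul_pow_mem_Ioo
    (u := max (1 - δ) (1 / 2) * t / s) (v := t / s) (by positivity)
    (by gcongr; exact mul_lt_of_lt_one_left ht0 hlt)
  rw [div_lt_iff₀ hs0] at hA
  rw [lt_div_iff₀ hs0] at hB
  have hct : ρ ^ n * r ^ m * s / t * t = ρ ^ n * (r ^ m * s) := by field_simp
  have hr0 := h.1
  have hle : ρ ^ n * (r ^ m * s) ≤ 1 := by linarith
  have hc : max (1 - δ) (1 / 2) < ρ ^ n * r ^ m * s / t := (lt_div_iff₀ ht0).2 hA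
  refine ⟨ρ ^ n * r ^ m * s / t, hpos.trans hc, (le_max_left _ _).trans_lt hc,
    ((div_lt_one ht0).2 hB).le, ?_⟩
  simp only [hct]
  have hpos' : 0 ≤ r ^ m * s := by positivity
  have hpos'' : 0 ≤ ρ ^ n * (r ^ m * s) :=
    mul_nonneg (pow_nonneg (zero_le_one.trans h.2.2.1.le) _) hpos'
  exact ((reflTransGen_level_zero ⟨hs0.le, hs1⟩ k).1.trans
    (reflTransGen_mul_left_pow hr0 h.2.1 ⟨hs0.le, hs1⟩ m)).trans
    ((reflTransGen_mul_right_pow h.2.2.1 hpos' n hle).trans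
      (reflTransGen_level_zero ⟨hpos'', hle⟩ l).2)

theorem iterate_shiftTwo_apply {X : Type} (F : Set (X × X)) (n : ℕ) (x : ↥(MahavierTwo F))
    (i : ℤ) : ((shiftTwo F)^[n] x).1 i = x.1 (i + n) := by
  induction n generalizing x with
  | zero => simp
  | succ n ih =>
    rw [Function.iterate_succ_apply, ih]
    exact congrArg x.1 (by push_cast; ring)

theorem topologicallyMixing_shiftTwo_Hrel (h : NeverConnect r ρ) :
    TopologicallyMixing (shiftTwo (Hrel r ρ)) := by
  intro U V hU hV hUne hVne
  obtain ⟨hr0, hr1, hρ, -⟩ := id h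
  obtain ⟨v, hv, hvU, hv0⟩ := exists_levelOrbit_pos_mem hr0 hr1 hρ hU hUne
  obtain ⟨w, hw, hwV, hw0⟩ := exists_levelOrbit_pos_mem hr0 hr1 hρ hV hVne
  obtain ⟨N, δ, hδ, hN⟩ := hv.exists_window hU hvU
  obtain ⟨M, ε, hε, hM⟩ := hw.exists_window hV hwV
  obtain ⟨c, hc0, hcε, hc1, hreach⟩ := h.exists_reflTransGen (a := v N) (b := w (-M))
    ⟨hv0 _, (hv _).1.2⟩ ⟨hw0 _, (hw _).1.2⟩ hε
  have hcw : LevelOrbit r ρ fun i => ((w i).1, c * (w i).2) :=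
    fun i => (hw i).scale ⟨hc0.le, hc1⟩
  obtain ⟨m, hm⟩ := hv.exists_eq_of_reflTransGen hreach (N := N) rfl
  refine ⟨N + m + M, fun n hn => ?_⟩
  obtain ⟨p, rfl⟩ := Nat.exists_eq_add_of_le hn
  obtain ⟨z, hz, hz1, hz2⟩ := hm (m + p) (by omega)
  obtain ⟨y, hy, hy1, hy2⟩ := hz.glue hcw hz2
  refine ⟨_, ⟨hy.toPt, ?_, rfl⟩, ?_⟩
  · refine hN 1 (by linarith) le_rfl _ fun i hi => ?_
    have hiN : i ≤ N := (le_abs_self i).trans hi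
    simp only [LevelOrbit.toPt, one_mul]
    rw [hy1 i (by push_cast; linarith [m.cast_nonneg (α := ℤ), p.cast_nonneg (α := ℤ)]),
      hz1 i hiN]
  · refine hM c hcε hc1 _ fun i hi => ?_
    rw [iterate_shiftTwo_apply]
    simp only [LevelOrbit.toPt]
    rw [← hy2 i (by linarith [neg_abs_le i])]
    congr 2
    push_cast
    ring

/-- The shift on the two-sided Mahavier product is a homeomorphism. -/
def shiftTwoHomeomorph {X : Type} [TopologicalSpace X] (F : Set (X × X)) :
    ↥(MahavierTwo F) ≃ₜ ↥(MahavierTwo F) where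
  toFun := shiftTwo F
  invFun x := ⟨fun i => x.1 (i - 1), fun i => by
    have := x.2 (i - 1)
    rwa [show i - 1 + 1 = i + 1 - 1 by ring] at this⟩
  left_inv x := by
    refine Subtype.ext (funext fun i => ?_)
    simp [shiftTwo]
  right_inv x := by
    refine Subtype.ext (funext fun i => ?_)
    simp [shiftTwo]
  continuous_toFun := Continuous.subtype_mk (continuous_pi fun i =>
    (continuous_apply (A := fun _ : ℤ => X) (i + 1)).comp continuous_subtype_val) _
  continuous_invFun := Continuous.subtype_mk (continuous_pi fun i =>
    (continuous_apply (A := fun _ : ℤ => X) (i - 1)).comp continuous_subtype_val) _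

/-- A homeomorphism compatible with a relation descends to the quotient. -/
def Homeomorph.quotMap {X : Type} [TopologicalSpace X] (e : X ≃ₜ X) {R : X → X → Prop}
    (h : ∀ x y, R x y → R (e x) (e y)) (h' : ∀ x y, R x y → R (e.symm x) (e.symm y)) :
    Quot R ≃ₜ Quot R where
  toFun := Quot.map e h
  invFun := Quot.map e.symm h'
  left_inv := by
    rintro ⟨x⟩
    simp [Quot.map]
  right_inv := by
    rintro ⟨x⟩
    simp [Quot.map]
  continuous_toFun := continuous_quot_lift _ (continuous_quot_mk.comp e.continuous)
  continuous_invFun := continuous_quot_lift _ (continuous_quot_mk.comp e.symm.continuous)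

theorem TopologicallyMixing.of_semiconj {X Y : Type} [TopologicalSpace X] [TopologicalSpace Y]
    {f : X → X} {g : Y → Y} (hf : TopologicallyMixing f) {π : X → Y} (hπ : Continuous π)
    (hsurj : Function.Surjective π) (h : Function.Semiconj π f g) : TopologicallyMixing g := by
  intro U V hU hV hUne hVne
  obtain ⟨n₀, hn₀⟩ := hf (π ⁻¹' U) (π ⁻¹' V) (hU.preimage hπ) (hV.preimage hπ)
    (hUne.preimage hsurj) (hVne.preimage hsurj)
  refine ⟨n₀, fun n hn => ?_⟩
  obtain ⟨_, ⟨x, hxU, rfl⟩, hxV⟩ := hn₀ n hn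
  refine ⟨_, ⟨π x, hxU, rfl⟩, ?_⟩
  rw [← (h.iterate_right n).eq]
  exact hxV

end Dynamics

/-- For `(r,ρ) ∈ 𝒩𝒞`, the shift `σ_H` induces a well-defined homeomorphism `σ_H⋆` of
`𝕏_H/~₂` with `[x] ↦ [σ_H x]`, and `(𝕏_H/~₂, σ_H⋆)` is topologically mixing. -/
theorem statement16 (r ρ : ℝ) (hNC : NeverConnect r ρ) :
    ∃ g : Quot (relTwo r ρ) → Quot (relTwo r ρ),
      (∀ x : ↥(MahavierTwo (Hrel r ρ)),
        g (Quot.mk _ x) = Quot.mk _ (shiftTwo (Hrel r ρ) x)) ∧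
      IsHomeomorph g ∧ TopologicallyMixing g := by
  let e := (shiftTwoHomeomorph (Hrel r ρ)).quotMap (R := relTwo r ρ)
    (fun x y h => h.imp (congrArg _) fun h i => h (i + 1))
    (fun x y h => h.imp (congrArg _) fun h i => h (i - 1))
  exact ⟨e, fun _ => rfl, e.isHomeomorph, (topologicallyMixing_shiftTwo_Hrel hNC).of_semiconj
    continuous_quot_mk Quot.mk_surjective fun _ => rfl⟩
end
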